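/- Let Γ be a G-set with exactly two valleys, the y-valley (i_y,j_y) and the z-valley (i_z,k_z), and write j = j(Γ), k = k(Γ). Then s_Γ((0,j+1,0)) = (−i_z−1, j+1, −k_z), s_Γ((i_y+1,j_y+1,0)) = (i_y+1, j_y+1, −k), and s_Γ((0,0,k+1)) = (−i_y−1, −j_y, k+1); the determinant of the 3×3 integer matrix with these three rows has absolute value r, and consequently these three vectors form a ℤ-basis of the lattice M = { u ∈ ℤ³ : wt(u) = 0 }. -/

import Mathlib

open scoped BigOperators Classical

namespace GH

/-- Exponent vectors of monomials `x^m y^n z^p`. -/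
abbrev N3 : Type := ℕ × ℕ × ℕ

/-- The lattice `ℤ³`. -/
abbrev Z3 : Type := ℤ × ℤ × ℤ

/-- Inclusion `ℕ³ → ℤ³`. -/
def toZ (v : N3) : Z3 := ((v.1 : ℤ), (v.2.1 : ℤ), (v.2.2 : ℤ))

/-- The weight map `wt(m,n,p) = m + a·n + (r−a)·p (mod r)` on `ℤ³`. -/
def wtZ (r a : ℕ) (v : Z3) : ZMod r :=
  (v.1 : ZMod r) + (a : ZMod r) * (v.2.1 : ZMod r) + ((r - a : ℕ) : ZMod r) * (v.2.2 : ZMod r)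

/-- The weight map on `ℕ³`. -/
def wtN (r a : ℕ) (v : N3) : ZMod r := wtZ r a (toZ v)

/-- A `G`-set: contains the origin, closed under taking summands, and the weight map
restricted to it is a bijection onto `ℤ/rℤ`. -/
structure IsGSet (r a : ℕ) (Γ : Set N3) : Prop where
  zero_mem : (0, 0, 0) ∈ Γ
  dclosed : ∀ u v : N3, u + v ∈ Γ → u ∈ Γ ∧ v ∈ Γ
  bij : Set.BijOn (wtN r a) Γ Set.univ

/-- `wt_Γ(v)`: the (unique, for a `G`-set) element of `Γ` of the same weight as `v`. -/
noncomputable def wtG (r a : ℕ) (Γ : Set N3) (v : N3) : N3 :=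
  if h : ∃ w, w ∈ Γ ∧ wtN r a w = wtN r a v then h.choose else (0, 0, 0)

/-- `(m,n)` is a y-valley of `Γ`. -/
def IsYValley (Γ : Set N3) (m n : ℕ) : Prop :=
  (m, n, 0) ∈ Γ ∧ (m + 1, n, 0) ∈ Γ ∧ (m, n + 1, 0) ∈ Γ ∧ (m + 1, n + 1, 0) ∉ Γ

/-- `(m,n)` is a z-valley of `Γ`. -/
def IsZValley (Γ : Set N3) (m n : ℕ) : Prop :=
  (m, 0, n) ∈ Γ ∧ (m + 1, 0, n) ∈ Γ ∧ (m, 0, n + 1) ∈ Γ ∧ (m + 1, 0, n + 1) ∉ Γ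

/-- A primitive `G`-set: it has a y-valley `(i_y, 0)` and a z-valley `(i_z, 0)`. -/
def IsPrimG (Γ : Set N3) : Prop := (∃ p : ℕ, IsYValley Γ p 0) ∧ (∃ p : ℕ, IsZValley Γ p 0)

/-- `s_Γ(v) = v − wt_Γ(v) ∈ ℤ³`. -/
noncomputable def sG (r a : ℕ) (Γ : Set N3) (v : N3) : Z3 := toZ v - toZ (wtG r a Γ v)

/-- The submonoid `S(Γ)` of `ℤ³` generated by all `s_Γ(v)`. -/
noncomputable def SMon (r a : ℕ) (Γ : Set N3) : AddSubmonoid Z3 :=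
  AddSubmonoid.closure (Set.range (sG r a Γ))

/-- The lattice `M = { u ∈ ℤ³ : wt(u) = 0 }` of `G`-invariant monomials. -/
def latM (r a : ℕ) : Set Z3 := { u | wtZ r a u = 0 }

/-- The standard pairing of `ℝ³` with `ℤ³`. -/
def dotR (α : ℝ × ℝ × ℝ) (u : Z3) : ℝ :=
  α.1 * (u.1 : ℝ) + α.2.1 * (u.2.1 : ℝ) + α.2.2 * (u.2.2 : ℝ)

/-- The cone `σ(Γ) = { α ∈ ℝ³ : ⟨α, s_Γ(v)⟩ ≥ 0 for all v ∈ ℕ³ }`. -/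
noncomputable def sigmaCone (r a : ℕ) (Γ : Set N3) : Set (ℝ × ℝ × ℝ) :=
  { α | ∀ v : N3, 0 ≤ dotR α (sG r a Γ v) }

/-- `span(u₁,…,u_t)`: all `v ∈ ℕ³` dominated componentwise by some `u_s`. -/
def spanSet (s : Set N3) : Set N3 := { v | ∃ u ∈ s, v ≤ u }

/-- `i(Γ)`: the largest `m` with `(m,0,0) ∈ Γ`. -/
noncomputable def iOf (Γ : Set N3) : ℕ := sSup { m : ℕ | (m, 0, 0) ∈ Γ }

/-- `j(Γ)`: the largest `n` with `(0,n,0) ∈ Γ`. -/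
noncomputable def jOf (Γ : Set N3) : ℕ := sSup { n : ℕ | (0, n, 0) ∈ Γ }

/-- `k(Γ)`: the largest `p` with `(0,0,p) ∈ Γ`. -/
noncomputable def kOf (Γ : Set N3) : ℕ := sSup { p : ℕ | (0, 0, p) ∈ Γ }

/-- `c(w) = max { c : w − c·v ∈ ℕ³ }` (componentwise). -/
noncomputable def cmax (v w : N3) : ℕ := sSup { c : ℕ | c • v ≤ w }

/-- The `G`-igsaw transformation of `Γ` in the direction of `u`:
`T_u(Γ) = { w + c(w)·(u − v) : w ∈ Γ }` where `v = wt_Γ(u)`. -/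
noncomputable def jig (r a : ℕ) (Γ : Set N3) (u : N3) : Set N3 :=
  { w' | ∃ w ∈ Γ,
      toZ w' = toZ w + (cmax (wtG r a Γ u) w) • (toZ u - toZ (wtG r a Γ u)) }

/-- The upper transformation `TU(Γ)`. -/
noncomputable def TU (r a : ℕ) (Γ : Set N3) : Set N3 := jig r a Γ (iOf Γ + 1, 0, 0)

/-- The right transformation `TR(Γ)`. -/
noncomputable def TR (r a : ℕ) (Γ : Set N3) : Set N3 := jig r a Γ (0, jOf Γ + 1, 0)

/-- The left transformation `TL(Γ)`. -/
noncomputable def TL (r a : ℕ) (Γ : Set N3) : Set N3 := jig r a Γ (0, 0, kOf Γ + 1)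

/-- The y-valley of `Γ` (chosen by choice; unique for a `G`-set having one). -/
noncomputable def yValley (Γ : Set N3) : ℕ × ℕ :=
  if h : ∃ p : ℕ × ℕ, IsYValley Γ p.1 p.2 then h.choose else (0, 0)

/-- The z-valley of `Γ` (chosen by choice; unique for a `G`-set having one). -/
noncomputable def zValley (Γ : Set N3) : ℕ × ℕ :=
  if h : ∃ p : ℕ × ℕ, IsZValley Γ p.1 p.2 then h.choose else (0, 0)

/-- The upper right transformation `TUR(Γ)`, in the direction `(i_y+1, j_y+1, 0)`. -/
noncomputable def TUR (r a : ℕ) (Γ : Set N3) : Set N3 :=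
  jig r a Γ ((yValley Γ).1 + 1, (yValley Γ).2 + 1, 0)

/-- The upper left transformation `TUL(Γ)`, in the direction `(i_z+1, 0, k_z+1)`. -/
noncomputable def TUL (r a : ℕ) (Γ : Set N3) : Set N3 :=
  jig r a Γ ((zValley Γ).1 + 1, 0, (zValley Γ).2 + 1)

/-- The bound `min{j, k, j − j_y, k − k_z}` for the triangle of transformations. -/
noncomputable def minBound (Γ : Set N3) : ℕ :=
  min (min (jOf Γ) (kOf Γ)) (min (jOf Γ - (yValley Γ).2) (kOf Γ - (zValley Γ).2))

/-- The triangle of transformations `Θ(Γ)`. -/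
noncomputable def Theta (r a : ℕ) (Γ : Set N3) : Set (Set N3) :=
  { Γ' | ∃ p q : ℕ, p + q ≤ minBound Γ ∧ Γ' = (TUR r a)^[p] ((TUL r a)^[q] Γ) }

/-- The recursion step producing `Γ_{n+1}` from `Γ_n`. -/
noncomputable def nextGamma (r a : ℕ) (Γ : Set N3) : Set N3 :=
  if jOf Γ < kOf Γ then TU r a ((TUR r a)^[jOf Γ] Γ)
  else TU r a ((TUL r a)^[kOf Γ] Γ)

/-- The sequence of primitive `G`-sets; `GammaSeq r a b (n-1)` is `Γ_n`,
starting from `Γ₁ = span((1,0,0),(0,b−1,0),(0,0,r−b−1))`. -/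
noncomputable def GammaSeq (r a b : ℕ) : ℕ → Set N3
  | 0 => spanSet {(1, 0, 0), (0, b - 1, 0), (0, 0, r - b - 1)}
  | n + 1 => nextGamma r a (GammaSeq r a b n)


/-- A down-closed set of exponents on which the weight `m + α (n - p)` is a bijection onto
`ℤ/rℤ`. In contrast to `IsGSet`, this notion is stable under exchanging `y` and `z`. -/
structure IsWeightSet {r : ℕ} (α : ZMod r) (Γ : Set N3) : Prop where
  down : ∀ {m n p m' n' p' : ℕ}, (m, n, p) ∈ Γ → m' ≤ m → n' ≤ n → p' ≤ p → (m', n', p') ∈ Γ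
  inj : ∀ {m n p m' n' p' : ℕ}, (m, n, p) ∈ Γ → (m', n', p') ∈ Γ →
    (m : ZMod r) + α * n - α * p = m' + α * n' - α * p' → m = m' ∧ n = n' ∧ p = p'
  surj : ∀ x : ZMod r, ∃ m n p : ℕ, (m, n, p) ∈ Γ ∧ (m : ZMod r) + α * n - α * p = x

/-- The set obtained by exchanging the variables `y` and `z`. -/
def swapYZ (Γ : Set N3) : Set N3 := {v | (v.1, v.2.2, v.2.1) ∈ Γ}

lemma mem_swapYZ {Γ : Set N3} {m n p : ℕ} : (m, n, p) ∈ swapYZ Γ ↔ (m, p, n) ∈ Γ := Iff.rfl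

lemma IsZValley.swapYZ {Γ : Set N3} {m n : ℕ} (h : IsZValley Γ m n) :
    IsYValley (swapYZ Γ) m n := h

lemma wtN_eq {r a : ℕ} (har : a ≤ r) (v : N3) :
    wtN r a v = (v.1 : ZMod r) + (a : ZMod r) * v.2.1 - (a : ZMod r) * v.2.2 := by
  simp [wtN, wtZ, toZ, Nat.cast_sub har]
  ring

lemma mem_latM_iff {r a : ℕ} (har : a ≤ r) (u : Z3) :
    u ∈ latM r a ↔
      (u.1 : ZMod r) + (a : ZMod r) * u.2.1 - (a : ZMod r) * u.2.2 = 0 := by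
  simp only [latM, wtZ, Set.mem_ofPred_eq, Nat.cast_sub har, CharP.cast_eq_zero]
  ring_nf

lemma IsGSet.isWeightSet {r a : ℕ} (har : a ≤ r) {Γ : Set N3} (h : IsGSet r a Γ) :
    IsWeightSet (a : ZMod r) Γ where
  down {m n p m' n' p'} hv hm hn hp := by
    refine (h.dclosed (m', n', p') (m - m', n - n', p - p') ?_).1
    simpa [Nat.add_sub_cancel' hm, Nat.add_sub_cancel' hn, Nat.add_sub_cancel' hp] using hv
  inj hv hw e := by
    have := h.bij.injOn hv hw (by simpa [wtN_eq har] using e)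
    simpa using this
  surj x := by
    obtain ⟨⟨m, n, p⟩, hv, e⟩ := h.bij.surjOn (Set.mem_univ x)
    exact ⟨m, n, p, hv, by simpa [wtN_eq har] using e⟩

lemma wtG_eq {r a : ℕ} {Γ : Set N3} (h : IsGSet r a Γ) {v w : N3} (hw : w ∈ Γ)
    (e : wtN r a w = wtN r a v) : wtG r a Γ v = w := by
  have hex : ∃ w, w ∈ Γ ∧ wtN r a w = wtN r a v := ⟨w, hw, e⟩
  rw [wtG, dif_pos hex]
  exact h.bij.injOn hex.choose_spec.1 hw (hex.choose_spec.2.trans e.symm)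

namespace IsWeightSet

variable {r : ℕ} {α : ZMod r} {Γ : Set N3}

lemma swapYZ (h : IsWeightSet α Γ) : IsWeightSet (-α) (swapYZ Γ) where
  down hv hm hn hp := h.down hv hm hp hn
  inj hv hw e := by
    have := h.inj hv hw (by linear_combination e)
    tauto
  surj x := by
    obtain ⟨m, n, p, hv, e⟩ := h.surj x
    exact ⟨m, p, n, hv, by linear_combination e⟩

/-- The point just outside a y-valley has the weight of the top of the `z`-axis. -/
lemma weight_yValley_corner (h : IsWeightSet α Γ) {m n k : ℕ} (hv : IsYValley Γ m n)
    (hk : (0, 0, k) ∈ Γ) (hk' : (0, 0, k + 1) ∉ Γ) :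
    ((m : ZMod r) + 1) + α * (n + 1) = -(α * k) := by
  obtain ⟨-, hx, hy, hxy⟩ := hv
  obtain ⟨p, q, t, hw, e⟩ := h.surj (((m : ZMod r) + 1) + α * (n + 1))
  have hp : p = 0 := by
    rcases p with _ | p
    · rfl
    · have := h.inj (h.down hw (Nat.le_succ p) le_rfl le_rfl) hy
        (by push_cast at e ⊢; linear_combination e)
      obtain ⟨rfl, rfl, rfl⟩ := this
      exact absurd hw hxy
  have hq : q = 0 := by
    rcases q with _ | q
    · rfl
    · have := h.inj (h.down hw le_rfl (Nat.le_succ q) le_rfl) hx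
        (by push_cast at e ⊢; linear_combination e)
      obtain ⟨rfl, rfl, rfl⟩ := this
      exact absurd hw hxy
  subst hp hq
  have htk : t ≤ k := by
    by_contra! hlt
    exact hk' (h.down hw le_rfl le_rfl hlt)
  have hkt : k ≤ t := by
    by_contra! hlt
    have := h.inj hx (h.down hk (p' := t + 1) le_rfl le_rfl hlt)
      (by push_cast at e ⊢; linear_combination -e)
    omega
  obtain rfl := le_antisymm htk hkt
  push_cast at e
  linear_combination -e

/-- At a unique y-valley the left column reaches the top of the `y`-axis. -/
lemma yValley_column_mem (h : IsWeightSet α Γ) {m n j : ℕ} (hv : IsYValley Γ m n)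
    (hu : ∀ m' n' : ℕ, IsYValley Γ m' n' → (m', n') = (m, n)) (hj : (0, j, 0) ∈ Γ) :
    (m, j, 0) ∈ Γ := by
  by_contra hmj
  have hex : ∃ q, (m, q, 0) ∉ Γ := ⟨j, hmj⟩
  obtain ⟨q, hq, hmin⟩ : ∃ q, (m, q, 0) ∉ Γ ∧ ∀ q' < q, (m, q', 0) ∈ Γ :=
    ⟨Nat.find hex, Nat.find_spec hex, fun q' hq' => not_not.1 (Nat.find_min hex hq')⟩
  have hqj : q ≤ j := by
    by_contra! hlt
    exact hmj (hmin j hlt)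
  have hnq : n + 1 < q := by
    by_contra! hle
    exact hq (h.down hv.2.2.1 le_rfl hle le_rfl)
  have hex' : ∃ p, (p, q, 0) ∉ Γ := ⟨m, hq⟩
  obtain ⟨p, hp, hmin'⟩ : ∃ p, (p, q, 0) ∉ Γ ∧ ∀ p' < p, (p', q, 0) ∈ Γ :=
    ⟨Nat.find hex', Nat.find_spec hex', fun q' hq' => not_not.1 (Nat.find_min hex' hq')⟩
  have hpm : p ≤ m := by
    by_contra! hlt
    exact hq (hmin' m hlt)
  obtain ⟨p, rfl⟩ : ∃ p', p = p' + 1 := by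
    refine Nat.exists_eq_succ_of_ne_zero ?_
    rintro rfl
    exact hp (h.down hj le_rfl hqj le_rfl)
  obtain ⟨q, rfl⟩ : ∃ q', q = q' + 1 := ⟨q - 1, by omega⟩
  have := hu p q ⟨h.down (hmin q (by omega)) (by omega) le_rfl le_rfl,
    h.down (hmin q (by omega)) hpm le_rfl le_rfl, hmin' p (by omega), hp⟩
  simp only [Prod.mk.injEq] at this
  omega

/-- At a unique y-valley the bottom row reaches the end of the `x`-axis. -/
lemma yValley_row_mem (h : IsWeightSet α Γ) {m n i : ℕ} (hv : IsYValley Γ m n)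
    (hu : ∀ m' n' : ℕ, IsYValley Γ m' n' → (m', n') = (m, n)) (hi : (i, 0, 0) ∈ Γ) :
    (i, n, 0) ∈ Γ := by
  by_contra hin
  have hex : ∃ p, (p, n, 0) ∉ Γ := ⟨i, hin⟩
  obtain ⟨p, hp, hmin⟩ : ∃ p, (p, n, 0) ∉ Γ ∧ ∀ p' < p, (p', n, 0) ∈ Γ :=
    ⟨Nat.find hex, Nat.find_spec hex, fun q' hq' => not_not.1 (Nat.find_min hex hq')⟩
  have hpi : p ≤ i := by
    by_contra! hlt
    exact hin (hmin i hlt)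
  have hmp : m + 1 < p := by
    by_contra! hle
    exact hp (h.down hv.2.1 hle le_rfl le_rfl)
  have hex' : ∃ q, (p, q, 0) ∉ Γ := ⟨n, hp⟩
  obtain ⟨q, hq, hmin'⟩ : ∃ q, (p, q, 0) ∉ Γ ∧ ∀ q' < q, (p, q', 0) ∈ Γ :=
    ⟨Nat.find hex', Nat.find_spec hex', fun q' hq' => not_not.1 (Nat.find_min hex' hq')⟩
  have hqn : q ≤ n := by
    by_contra! hlt
    exact hp (hmin' n hlt)
  obtain ⟨q, rfl⟩ : ∃ q', q = q' + 1 := by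
    refine Nat.exists_eq_succ_of_ne_zero ?_
    rintro rfl
    exact hq (h.down hi hpi le_rfl le_rfl)
  obtain ⟨p, rfl⟩ : ∃ p', p = p' + 1 := ⟨p - 1, by omega⟩
  have := hu p q ⟨h.down (hmin p (by omega)) le_rfl (by omega) le_rfl, hmin' q (by omega),
    h.down (hmin p (by omega)) le_rfl hqn le_rfl, hq⟩
  simp only [Prod.mk.injEq] at this
  omega

/-- For `-k ≤ c ≤ j` the weight `α c` is attained on the `y`-axis or the `z`-axis. -/
lemma exists_axis_mem (h : IsWeightSet α Γ) {j k : ℕ} (hj : (0, j, 0) ∈ Γ)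
    (hk : (0, 0, k) ∈ Γ) {c : ℤ} (hcj : c ≤ j) (hck : -c ≤ k) :
    ∃ n p : ℕ, (0, n, p) ∈ Γ ∧ α * n - α * p = α * c := by
  rcases le_total 0 c with hc | hc
  · lift c to ℕ using hc
    exact ⟨c, 0, h.down hj le_rfl (by omega) le_rfl, by simp⟩
  · obtain ⟨d, rfl⟩ : ∃ d : ℕ, c = -d := ⟨(-c).toNat, by omega⟩
    exact ⟨0, d, h.down hk le_rfl le_rfl (by omega), by simp⟩

/-- If `(i + 1, 0, 0)` has the weight of a point `(0, t, 0)` with `t ≤ j`, then `i + 1` is at least the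
sum of the two valley abscissae. -/
lemma valley_sum_le (h : IsWeightSet α Γ) {i j k m n m' n' t : ℕ}
    (hi : (i, 0, 0) ∈ Γ) (hj : (0, j, 0) ∈ Γ) (hk : (0, 0, k) ∈ Γ)
    (hin : (i, n, 0) ∈ Γ) (hm : m + 1 ≤ i) (hm' : m' + 1 ≤ i) (hn' : n' ≤ k)
    (hα : ((m : ZMod r) + 1) + α * (n + 1) = -(α * k))
    (hβ : ((m' : ZMod r) + 1) - α * (n' + 1) = α * j)
    (htj : t ≤ j) (hwt : (i : ZMod r) + 1 = α * t) :
    m + m' + 2 ≤ i + 1 := by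
  by_contra! hlt
  rcases le_or_gt (t + n) j with hle | hgt
  · obtain ⟨q, p, hqp, e⟩ := h.exists_axis_mem hj hk
      (c := (j : ℤ) - n - t - (k - n')) (by omega) (by omega)
    have := h.inj hqp (h.down hi (m' := m + m' + 2 - (i + 1)) (n' := 0) (p' := 0)
      (by omega) le_rfl le_rfl) (by
        rw [Nat.cast_sub hlt.le]
        push_cast at e ⊢
        linear_combination e - hα - hβ + hwt)
    omega
  · have := h.inj (h.down hin (m' := i + 1 - (m' + 1)) (n' := j + 1 - t) (p' := 0)
      (by omega) (by omega) le_rfl) (h.down hk (p' := n') le_rfl le_rfl hn') (by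
        rw [Nat.cast_sub (by omega), Nat.cast_sub (by omega)]
        push_cast
        linear_combination hwt - hβ)
    omega

/-- The valley abscissae of a set with two valleys determine the end of the `x`-axis. -/
lemma eq_valley_sum (h : IsWeightSet α Γ) {i j k m n m' n' : ℕ}
    (hi : (i, 0, 0) ∈ Γ) (hi' : (i + 1, 0, 0) ∉ Γ)
    (hj : (0, j, 0) ∈ Γ) (hj' : (0, j + 1, 0) ∉ Γ)
    (hk : (0, 0, k) ∈ Γ) (hk' : (0, 0, k + 1) ∉ Γ)
    (hin : (i, n, 0) ∈ Γ) (hin' : (i, 0, n') ∈ Γ) (hm : m + 1 ≤ i) (hm' : m' + 1 ≤ i)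
    (hn : n ≤ j) (hn' : n' ≤ k)
    (hα : ((m : ZMod r) + 1) + α * (n + 1) = -(α * k))
    (hβ : ((m' : ZMod r) + 1) - α * (n' + 1) = α * j) :
    i = m + m' + 1 := by
  refine le_antisymm ?_ ?_
  · by_contra! hlt
    obtain ⟨q, p, hqp, e⟩ := h.exists_axis_mem hj hk
      (c := (j : ℤ) - n - (k - n')) (by omega) (by omega)
    have := h.inj hqp (h.down hi (m' := m + m' + 2) (n' := 0) (p' := 0)
      (by omega) le_rfl le_rfl) (by
        push_cast at e ⊢
        linear_combination e - hα - hβ)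
    omega
  · suffices m + m' + 2 ≤ i + 1 by omega
    obtain ⟨p, q, t, hw, e⟩ := h.surj ((i : ZMod r) + 1)
    have hp : p = 0 := by
      rcases p with _ | p
      · rfl
      · have := h.inj (h.down hw (Nat.le_succ p) le_rfl le_rfl) hi
          (by push_cast at e ⊢; linear_combination e)
        obtain ⟨rfl, rfl, rfl⟩ := this
        exact absurd hw hi'
    subst hp
    have hqt : q = 0 ∨ t = 0 := by
      by_contra! hne
      have := h.inj (h.down hw (m' := 0) (n' := 1) (p' := 1) le_rfl (by omega) (by omega))
        (h.down hw (m' := 0) (n' := 0) (p' := 0) le_rfl (by omega) (by omega)) (by simp)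
      omega
    rcases hqt with rfl | rfl
    · have htk : t ≤ k := by
        by_contra! hlt
        exact hk' (h.down hw le_rfl le_rfl hlt)
      have := h.swapYZ.valley_sum_le (i := i) (j := k) (k := j) (m := m') (n := n') (m' := m)
        (n' := n) (t := t) hi hk hj hin' hm' hm hn (by linear_combination hβ)
        (by linear_combination hα) htk (by push_cast at e; linear_combination -e)
      omega
    · have htj : q ≤ j := by
        by_contra! hlt
        exact hj' (h.down hw le_rfl hlt le_rfl)
      exact h.valley_sum_le hi hj hk hin hm hm' hn' hα hβ htj
        (by push_cast at e; linear_combination -e)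

/-- The four boxes filling a set with two valleys contain at most `r` points. -/
lemma boxes_card_le [NeZero r] (h : IsWeightSet α Γ) {j k m n m' n' : ℕ}
    (hyc : (m, j, 0) ∈ Γ) (hyr : (m + m' + 1, n, 0) ∈ Γ)
    (hzc : (m', 0, k) ∈ Γ) (hzr : (m + m' + 1, 0, n') ∈ Γ) :
    (m + 1) * (j + 1) + (m' + 1) * (n + 1) + (m' + 1) * k + (m + 1) * n' ≤ r := by
  let A : Finset N3 := Finset.range (m + 1) ×ˢ Finset.range (j + 1) ×ˢ {0}
  let B : Finset N3 := Finset.Ico (m + 1) (m + 1 + (m' + 1)) ×ˢ Finset.range (n + 1) ×ˢ {0}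
  let C : Finset N3 := Finset.range (m' + 1) ×ˢ {0} ×ˢ Finset.Ioc 0 k
  let D : Finset N3 := Finset.Ico (m' + 1) (m' + 1 + (m + 1)) ×ˢ {0} ×ˢ Finset.Ioc 0 n'
  have hAB : Disjoint A B := by
    rw [Finset.disjoint_left]
    rintro ⟨x, y, z⟩
    simp [A, B]
    omega
  have hABC : Disjoint (A ∪ B) C := by
    rw [Finset.disjoint_left]
    rintro ⟨x, y, z⟩
    simp [A, B, C]
    omega
  have hABCD : Disjoint (A ∪ B ∪ C) D := by
    rw [Finset.disjoint_left]
    rintro ⟨x, y, z⟩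
    simp [A, B, C, D]
    omega
  have hsub : ∀ v ∈ A ∪ B ∪ C ∪ D, v ∈ Γ := by
    rintro ⟨x, y, z⟩ hv
    simp only [A, B, C, D, Finset.mem_union, Finset.mem_product, Finset.mem_range,
      Finset.mem_Ico, Finset.mem_Ioc, Finset.mem_singleton] at hv
    rcases hv with ((hv | hv) | hv) | hv
    · exact h.down hyc (by omega) (by omega) (by omega)
    · exact h.down hyr (by omega) (by omega) (by omega)
    · exact h.down hzc (by omega) (by omega) (by omega)
    · exact h.down hzr (by omega) (by omega) (by omega)
  have hcard := Finset.card_le_card_of_injOn (s := A ∪ B ∪ C ∪ D) (t := Finset.univ)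
    (fun v : N3 => (v.1 : ZMod r) + α * v.2.1 - α * v.2.2) (fun _ _ => Finset.mem_univ _) (by
      rintro ⟨x, y, z⟩ hv ⟨x', y', z'⟩ hv' e
      obtain ⟨rfl, rfl, rfl⟩ := h.inj (hsub _ hv) (hsub _ hv') e
      rfl)
  rw [Finset.card_univ, ZMod.card, Finset.card_union_of_disjoint hABCD,
    Finset.card_union_of_disjoint hABC, Finset.card_union_of_disjoint hAB] at hcard
  simp only [A, B, C, D, Finset.card_product, Finset.card_range, Finset.card_singleton,
    Nat.card_Ico, Nat.card_Ioc, Nat.add_sub_cancel_left, Nat.sub_zero] at hcard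
  linarith

end IsWeightSet

/-- The determinant of three vectors of the lattice `M` is divisible by `r`. -/
lemma dvd_det_of_mem_latM {r a : ℕ} (har : a ≤ r) {u v w : Z3} (hu : u ∈ latM r a)
    (hv : v ∈ latM r a) (hw : w ∈ latM r a) :
    (r : ℤ) ∣ Matrix.det !![u.1, u.2.1, u.2.2; v.1, v.2.1, v.2.2; w.1, w.2.1, w.2.2] := by
  rw [mem_latM_iff har] at hu hv hw
  rw [← ZMod.intCast_zmod_eq_zero_iff_dvd, Matrix.det_fin_three]
  simp
  linear_combination ((v.2.1 : ZMod r) * w.2.2 - v.2.2 * w.2.1) * hu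
    + ((w.2.1 : ZMod r) * u.2.2 - w.2.2 * u.2.1) * hv
    + ((u.2.1 : ZMod r) * v.2.2 - u.2.2 * v.2.1) * hw

/-- Three vectors of `M` of determinant `-r` form a `ℤ`-basis of `M`. -/
lemma existsUnique_combination_of_det {r a : ℕ} (har : a ≤ r) (hr : r ≠ 0) {v₁ v₂ v₃ : Z3}
    (h₁ : v₁ ∈ latM r a) (h₂ : v₂ ∈ latM r a) (h₃ : v₃ ∈ latM r a)
    (hdet : Matrix.det !![v₁.1, v₁.2.1, v₁.2.2; v₂.1, v₂.2.1, v₂.2.2; v₃.1, v₃.2.1, v₃.2.2]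
      = -(r : ℤ)) {u : Z3} (hu : u ∈ latM r a) :
    ∃! c : ℤ × ℤ × ℤ, u = c.1 • v₁ + c.2.1 • v₂ + c.2.2 • v₃ := by
  obtain ⟨c₁, e₁⟩ := dvd_det_of_mem_latM har hu h₂ h₃
  obtain ⟨c₂, e₂⟩ := dvd_det_of_mem_latM har h₁ hu h₃
  obtain ⟨c₃, e₃⟩ := dvd_det_of_mem_latM har h₁ h₂ hu
  have hr' : (r : ℤ) ≠ 0 := by exact_mod_cast hr
  obtain ⟨x₁, y₁, z₁⟩ := v₁
  obtain ⟨x₂, y₂, z₂⟩ := v₂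
  obtain ⟨x₃, y₃, z₃⟩ := v₃
  obtain ⟨x, y, z⟩ := u
  simp [Matrix.det_fin_three] at hdet e₁ e₂ e₃
  refine ⟨(-c₁, -c₂, -c₃), ?_, ?_⟩
  · simp only [Prod.smul_mk, Prod.mk_add_mk, Prod.mk.injEq, smul_eq_mul]
    refine ⟨?_, ?_, ?_⟩ <;> apply mul_left_cancel₀ hr'
    · linear_combination x * hdet - x₁ * e₁ - x₂ * e₂ - x₃ * e₃
    · linear_combination y * hdet - y₁ * e₁ - y₂ * e₂ - y₃ * e₃
    · linear_combination z * hdet - z₁ * e₁ - z₂ * e₂ - z₃ * e₃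
  · rintro ⟨d₁, d₂, d₃⟩ hd
    simp only [Prod.smul_mk, Prod.mk_add_mk, Prod.mk.injEq, smul_eq_mul] at hd
    obtain ⟨rfl, rfl, rfl⟩ := hd
    simp only [Prod.mk.injEq]
    refine ⟨?_, ?_, ?_⟩ <;> apply mul_left_cancel₀ hr'
    · linear_combination d₁ * hdet - e₁
    · linear_combination d₂ * hdet - e₂
    · linear_combination d₃ * hdet - e₃

/-- For a `G`-set with two valleys: explicit values of `s_Γ(β), s_Γ(δ_y), s_Γ(γ)`,
the determinant of the matrix of these rows has absolute value `r`, and they form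
a `ℤ`-basis of the lattice `M`. -/
theorem stmt7 (r a : ℕ) (hra : Nat.Coprime r a) (ha2 : 2 ≤ a) (halt : a < r - a) (Γ : Set N3) (hΓ : IsGSet r a Γ)
    (iy jy iz kz : ℕ)
    (hyv : IsYValley Γ iy jy) (hzv : IsZValley Γ iz kz)
    (hyu : ∀ m n : ℕ, IsYValley Γ m n → (m, n) = (iy, jy))
    (hzu : ∀ m n : ℕ, IsZValley Γ m n → (m, n) = (iz, kz))
    (i j k : ℕ)
    (hi : (i, 0, 0) ∈ Γ ∧ (i + 1, 0, 0) ∉ Γ)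
    (hj : (0, j, 0) ∈ Γ ∧ (0, j + 1, 0) ∉ Γ)
    (hk : (0, 0, k) ∈ Γ ∧ (0, 0, k + 1) ∉ Γ) :
    sG r a Γ (0, j + 1, 0) = (-(iz : ℤ) - 1, (j : ℤ) + 1, -(kz : ℤ)) ∧
    sG r a Γ (iy + 1, jy + 1, 0) = ((iy : ℤ) + 1, (jy : ℤ) + 1, -(k : ℤ)) ∧
    sG r a Γ (0, 0, k + 1) = (-(iy : ℤ) - 1, -(jy : ℤ), (k : ℤ) + 1) ∧
    (Matrix.det !![-(iz : ℤ) - 1, (j : ℤ) + 1, -(kz : ℤ);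
                   (iy : ℤ) + 1, (jy : ℤ) + 1, -(k : ℤ);
                   -(iy : ℤ) - 1, -(jy : ℤ), (k : ℤ) + 1]).natAbs = r ∧
    sG r a Γ (0, j + 1, 0) ∈ latM r a ∧
    sG r a Γ (iy + 1, jy + 1, 0) ∈ latM r a ∧
    sG r a Γ (0, 0, k + 1) ∈ latM r a ∧
    ∀ u ∈ latM r a, ∃! c : ℤ × ℤ × ℤ,
      u = c.1 • sG r a Γ (0, j + 1, 0) + c.2.1 • sG r a Γ (iy + 1, jy + 1, 0) +
          c.2.2 • sG r a Γ (0, 0, k + 1) := by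
  have har : a ≤ r := by omega
  have hr : r ≠ 0 := by omega
  have : NeZero r := ⟨hr⟩
  have h := hΓ.isWeightSet har
  have hz : IsYValley (swapYZ Γ) iz kz := hzv.swapYZ
  have hα := h.weight_yValley_corner hyv hk.1 hk.2
  have hβ : ((iz : ZMod r) + 1) - (a : ZMod r) * (kz + 1) = a * j := by
    linear_combination h.swapYZ.weight_yValley_corner hz hj.1 hj.2
  have hyc := h.yValley_column_mem hyv hyu hj.1
  have hyr := h.yValley_row_mem hyv hyu hi.1
  have hzc : (iz, 0, k) ∈ Γ := h.swapYZ.yValley_column_mem hz hzu hk.1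
  have hzr : (i, 0, kz) ∈ Γ := h.swapYZ.yValley_row_mem hz hzu hi.1
  have hm : iy + 1 ≤ i := by
    by_contra! hlt
    exact hi.2 (h.down hyv.2.1 hlt (Nat.zero_le _) le_rfl)
  have hm' : iz + 1 ≤ i := by
    by_contra! hlt
    exact hi.2 (h.down hzv.2.1 hlt le_rfl (Nat.zero_le _))
  have hn : jy ≤ j := by
    by_contra! hlt
    exact hj.2 (h.down hyv.1 (Nat.zero_le _) hlt le_rfl)
  have hn' : kz ≤ k := by
    by_contra! hlt
    exact hk.2 (h.down hzv.1 (Nat.zero_le _) le_rfl hlt)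
  obtain rfl := h.eq_valley_sum hi.1 hi.2 hj.1 hj.2 hk.1 hk.2 hyr hzr hm hm' hn hn' hα hβ
  have s₁ : sG r a Γ (0, j + 1, 0) = (-(iz : ℤ) - 1, (j : ℤ) + 1, -(kz : ℤ)) := by
    rw [sG, wtG_eq hΓ hzv.2.1 (by
      rw [wtN_eq har, wtN_eq har]
      push_cast
      linear_combination hβ)]
    simp [toZ]
    ring
  have s₂ : sG r a Γ (iy + 1, jy + 1, 0) = ((iy : ℤ) + 1, (jy : ℤ) + 1, -(k : ℤ)) := by
    rw [sG, wtG_eq hΓ hk.1 (by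
      rw [wtN_eq har, wtN_eq har]
      push_cast
      linear_combination -hα)]
    simp [toZ]
  have s₃ : sG r a Γ (0, 0, k + 1) = (-(iy : ℤ) - 1, -(jy : ℤ), (k : ℤ) + 1) := by
    rw [sG, wtG_eq hΓ hyv.2.1 (by
      rw [wtN_eq har, wtN_eq har]
      push_cast
      linear_combination hα)]
    simp [toZ]
    ring
  rw [s₁, s₂, s₃]
  have m₁ : ((-(iz : ℤ) - 1, (j : ℤ) + 1, -(kz : ℤ)) : Z3) ∈ latM r a := by
    rw [mem_latM_iff har]
    push_cast
    linear_combination -hβ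
  have m₂ : (((iy : ℤ) + 1, (jy : ℤ) + 1, -(k : ℤ)) : Z3) ∈ latM r a := by
    rw [mem_latM_iff har]
    push_cast
    linear_combination hα
  have m₃ : ((-(iy : ℤ) - 1, -(jy : ℤ), (k : ℤ) + 1) : Z3) ∈ latM r a := by
    rw [mem_latM_iff har]
    push_cast
    linear_combination -hα
  have hdvd := dvd_det_of_mem_latM har m₁ m₂ m₃
  have hdet : Matrix.det !![-(iz : ℤ) - 1, (j : ℤ) + 1, -(kz : ℤ);
      (iy : ℤ) + 1, (jy : ℤ) + 1, -(k : ℤ);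
      -(iy : ℤ) - 1, -(jy : ℤ), (k : ℤ) + 1] = -(r : ℤ) := by
    have hle := h.boxes_card_le hyc hyr hzc hzr
    have e : Matrix.det !![-(iz : ℤ) - 1, (j : ℤ) + 1, -(kz : ℤ);
        (iy : ℤ) + 1, (jy : ℤ) + 1, -(k : ℤ); -(iy : ℤ) - 1, -(jy : ℤ), (k : ℤ) + 1]
        = -(((iy + 1) * (j + 1) + (iz + 1) * (jy + 1) + (iz + 1) * k + (iy + 1) * kz : ℕ) : ℤ) := by
      simp [Matrix.det_fin_three]
      ring
    simp only [e, dvd_neg, Int.natCast_dvd_natCast] at hdvd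
    rw [e, le_antisymm hle (Nat.le_of_dvd (by positivity) hdvd)]
  exact ⟨rfl, rfl, rfl, by simp [hdet], m₁, m₂, m₃,
    fun u hu => existsUnique_combination_of_det har hr m₁ m₂ m₃ hdet hu⟩

end GH
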